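/- Inversion formula for the Laplace-type transform: for every integer m ≥ 1, ψ(m) = ψ(0) + ∑_{j=0}^{m−1} p^{-j} [ Φ(−j+1) − Φ(−j) ] and ψ(−m) = ψ(0) + ∑_{j=1}^{m} p^{j} [ Φ(j) − Φ(j+1) ]. -/

import Mathlib

open MeasureTheory Complex

noncomputable section

variable (p : ℕ) [Fact p.Prime] [MeasurableSpace ℚ_[p]] [BorelSpace ℚ_[p]]

/-- The radial function `v_0`: equal to `1` for `‖z‖ ≤ 1`, to `−1/(p−1)` for `‖z‖ = p`,
and to `0` for `‖z‖ ≥ p²`. -/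
def v0 (z : ℚ_[p]) : ℂ :=
  if ‖z‖ ≤ 1 then 1
  else if ‖z‖ = (p : ℝ) then -1 / ((p : ℂ) - 1)
  else 0

/-- The Laplace-type transform `φ̃(ξ) = ∫_{ℚ_p} v_0(xξ) φ(x) dμ(x)`. -/
def laplace (μ : Measure ℚ_[p]) (φ : ℚ_[p] → ℂ) (ξ : ℚ_[p]) : ℂ :=
  ∫ x, v0 p (x * ξ) * φ x ∂μ

/-- `Φ(n)`: the value of the Laplace-type transform at any `ξ` with `‖ξ‖ = pⁿ`
(here taken at `ξ = p^{-n}`, which has norm `pⁿ`). -/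
def Phi (μ : Measure ℚ_[p]) (φ : ℚ_[p] → ℂ) (n : ℤ) : ℂ :=
  laplace p μ φ ((p : ℚ_[p]) ^ (-n))

open Metric

theorem closedBall_zpow_succ_eq_biUnion (p : ℕ) [Fact p.Prime] (k : ℤ) :
    closedBall (0 : ℚ_[p]) ((p : ℝ) ^ (k + 1)) =
      ⋃ i ∈ Finset.range p,
        closedBall ((i : ℚ_[p]) * (p : ℚ_[p]) ^ (-(k + 1))) ((p : ℝ) ^ k) := by
  have hp : (p : ℚ_[p]) ≠ 0 := mod_cast (Fact.out : p.Prime).ne_zero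
  have hpR : (0 : ℝ) < p := mod_cast (Fact.out : p.Prime).pos
  ext x
  simp only [Set.mem_iUnion, mem_closedBall_iff_norm, sub_zero, Finset.mem_range, exists_prop]
  constructor
  · intro hx
    have hy : ‖x * (p : ℚ_[p]) ^ (k + 1)‖ ≤ 1 := by
      rw [norm_mul, Padic.norm_p_zpow, zpow_neg, ← div_eq_mul_inv]
      exact div_le_one_of_le₀ hx (by positivity)
    obtain ⟨n, hn, hxn⟩ := PadicInt.exists_mem_range (⟨_, hy⟩ : ℤ_[p])
    refine ⟨n, hn, ?_⟩
    rw [IsLocalRing.mem_maximalIdeal, PadicInt.mem_nonunits, PadicInt.norm_def] at hxn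
    change ‖x * (p : ℚ_[p]) ^ (k + 1) - ((n : ℤ_[p]) : ℚ_[p])‖ < 1 at hxn
    rw [PadicInt.coe_natCast] at hxn
    rw [Padic.norm_le_pow_iff_norm_lt_pow_add_one]
    have : x - n * (p : ℚ_[p]) ^ (-(k + 1)) =
        (x * (p : ℚ_[p]) ^ (k + 1) - n) * (p : ℚ_[p]) ^ (-(k + 1)) := by
      rw [zpow_neg]
      field_simp
    rw [this, norm_mul, Padic.norm_p_zpow, neg_neg]
    exact mul_lt_of_lt_one_left (by positivity) hxn
  · rintro ⟨n, -, hxn⟩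
    have hn : ‖(n : ℚ_[p]) * (p : ℚ_[p]) ^ (-(k + 1))‖ ≤ (p : ℝ) ^ (k + 1) := by
      rw [norm_mul, Padic.norm_p_zpow, neg_neg]
      exact mul_le_of_le_one_left (by positivity) (IsUltrametricDist.norm_natCast_le_one _ n)
    rw [← sub_add_cancel x (n * (p : ℚ_[p]) ^ (-(k + 1)))]
    exact (Padic.nonarchimedean _ _).trans
      (max_le ((Padic.norm_le_pow_iff_norm_lt_pow_add_one _ _).1 hxn).le hn)

theorem pairwiseDisjoint_closedBall_natCast_mul_zpow (p : ℕ) [Fact p.Prime] (k : ℤ) :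
    (Finset.range p : Set ℕ).PairwiseDisjoint fun i : ℕ =>
      closedBall ((i : ℚ_[p]) * (p : ℚ_[p]) ^ (-(k + 1))) ((p : ℝ) ^ k) := by
  have hpR : (0 : ℝ) < p := mod_cast (Fact.out : p.Prime).pos
  intro i hi j hj hij
  refine Set.disjoint_left.2 fun x hxi hxj => hij ?_
  rw [mem_closedBall_iff_norm] at hxi hxj
  rw [norm_sub_rev] at hxi
  have h : ‖((i : ℚ_[p]) - j) * (p : ℚ_[p]) ^ (-(k + 1))‖ < (p : ℝ) ^ (k + 1) := by
    rw [← Padic.norm_le_pow_iff_norm_lt_pow_add_one]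
    have := Padic.nonarchimedean ((i : ℚ_[p]) * (p : ℚ_[p]) ^ (-(k + 1)) - x)
      (x - (j : ℚ_[p]) * (p : ℚ_[p]) ^ (-(k + 1)))
    rw [sub_add_sub_cancel, ← sub_mul] at this
    exact this.trans (max_le hxi hxj)
  rw [norm_mul, Padic.norm_p_zpow, neg_neg, mul_lt_iff_lt_one_left (by positivity)] at h
  have h' : ‖(((i : ℤ) - j : ℤ) : ℚ_[p])‖ < 1 := by simpa using h
  have hd := Padic.norm_intCast_lt_one_iff.1 h'
  have := Finset.mem_range.1 hi
  have := Finset.mem_range.1 hj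
  have := Int.eq_zero_of_abs_lt_dvd hd (by rw [abs_lt]; constructor <;> omega)
  omega

section Haar

variable (μ : Measure ℚ_[p]) [μ.IsAddHaarMeasure]

theorem measureReal_closedBall_zpow_succ (k : ℤ) :
    μ.real (closedBall 0 ((p : ℝ) ^ (k + 1))) = p * μ.real (closedBall 0 ((p : ℝ) ^ k)) := by
  have htrans (a : ℚ_[p]) (r : ℝ) : μ (closedBall a r) = μ (closedBall 0 r) := by
    rw [← measure_preimage_add μ a (closedBall a r)]
    congr 1
    ext x
    simp [dist_eq_norm]
  rw [measureReal_def, closedBall_zpow_succ_eq_biUnion,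
    measure_biUnion_finset (pairwiseDisjoint_closedBall_natCast_mul_zpow p k)
      fun _ _ => measurableSet_closedBall]
  simp [htrans, measureReal_def]

theorem measureReal_closedBall_zpow (hμ : μ {x : ℚ_[p] | ‖x‖ ≤ 1} = 1) (k : ℤ) :
    μ.real (closedBall 0 ((p : ℝ) ^ k)) = (p : ℝ) ^ k := by
  have hpR : (p : ℝ) ≠ 0 := mod_cast (Fact.out : p.Prime).ne_zero
  induction k using Int.induction_on with
  | zero =>
    have : closedBall (0 : ℚ_[p]) 1 = {x | ‖x‖ ≤ 1} := by ext; simp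
    simp [measureReal_def, this, hμ]
  | succ k ih => rw [measureReal_closedBall_zpow_succ, ih, zpow_add_one₀ hpR, mul_comm]
  | pred k ih =>
    have h := measureReal_closedBall_zpow_succ p μ (-(k : ℤ) - 1)
    rw [sub_add_cancel, ih] at h
    refine mul_left_cancel₀ hpR ?_
    rw [← h, zpow_sub_one₀ hpR, mul_comm, inv_mul_cancel_right₀ hpR]

theorem closedBall_zpow_eq_union_sphere (p : ℕ) [Fact p.Prime] (k : ℤ) :
    closedBall (0 : ℚ_[p]) ((p : ℝ) ^ k) =
      closedBall 0 ((p : ℝ) ^ (k - 1)) ∪ sphere 0 ((p : ℝ) ^ k) := by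
  ext x
  simp only [Set.mem_union, mem_closedBall, mem_sphere, dist_zero_right]
  rw [← Padic.norm_lt_pow_iff_norm_le_pow_sub_one, le_iff_lt_or_eq]

theorem disjoint_closedBall_zpow_sphere (p : ℕ) [Fact p.Prime] (k : ℤ) :
    Disjoint (closedBall (0 : ℚ_[p]) ((p : ℝ) ^ (k - 1))) (sphere 0 ((p : ℝ) ^ k)) := by
  refine Set.disjoint_left.2 fun x hx hx' => ?_
  rw [mem_closedBall, dist_zero_right, ← Padic.norm_lt_pow_iff_norm_le_pow_sub_one] at hx
  rw [mem_sphere, dist_zero_right] at hx'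
  exact hx.ne hx'

theorem measureReal_sphere_zpow (hμ : μ {x : ℚ_[p] | ‖x‖ ≤ 1} = 1) (k : ℤ) :
    μ.real (sphere 0 ((p : ℝ) ^ k)) = (p : ℝ) ^ k - (p : ℝ) ^ (k - 1) := by
  have h := measureReal_closedBall_zpow p μ hμ k
  rw [closedBall_zpow_eq_union_sphere, measureReal_union (disjoint_closedBall_zpow_sphere p k)
    isClosed_sphere.measurableSet (isCompact_closedBall _ _).measure_lt_top.ne
    (isCompact_sphere _ _).measure_lt_top.ne, measureReal_closedBall_zpow p μ hμ] at h
  linarith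

theorem closedBall_zpow_eq_singleton_union_iUnion_sphere (p : ℕ) [Fact p.Prime] (K : ℤ) :
    closedBall (0 : ℚ_[p]) ((p : ℝ) ^ K) =
      {0} ∪ ⋃ n : ℕ, sphere (0 : ℚ_[p]) ((p : ℝ) ^ (K - (n : ℤ))) := by
  have hp1 : (1 : ℝ) < p := mod_cast (Fact.out : p.Prime).one_lt
  ext x
  simp only [Set.mem_union, mem_closedBall, mem_sphere, dist_zero_right, Set.mem_iUnion,
    Set.mem_singleton_iff]
  constructor
  · intro hx
    refine or_iff_not_imp_left.2 fun h0 => ?_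
    rw [Padic.norm_eq_zpow_neg_valuation h0] at hx ⊢
    have := (zpow_le_zpow_iff_right₀ hp1).1 hx
    exact ⟨(K + x.valuation).toNat, by congr 1; omega⟩
  · rintro (rfl | ⟨n, hn⟩)
    · simp only [norm_zero]; positivity
    · rw [hn]
      exact zpow_le_zpow_right₀ hp1.le (by omega)

section Radial

variable {φ : ℚ_[p] → ℂ} {ψ : ℤ → ℂ}

theorem integrableOn_sphere_zpow (hψ : ∀ (x : ℚ_[p]) (k : ℤ), ‖x‖ = (p : ℝ) ^ k → φ x = ψ k)
    (k : ℤ) : IntegrableOn φ (sphere 0 ((p : ℝ) ^ k)) μ :=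
  (integrableOn_const (isCompact_sphere _ _).measure_lt_top.ne).congr_fun
    (fun x hx => (hψ x k (by simpa using hx)).symm) isClosed_sphere.measurableSet

theorem integrableOn_closedBall_zpow (hμ : μ {x : ℚ_[p] | ‖x‖ ≤ 1} = 1)
    (hψ : ∀ (x : ℚ_[p]) (k : ℤ), ‖x‖ = (p : ℝ) ^ k → φ x = ψ k)
    {K : ℤ} (hint : Summable fun n : ℕ => (p : ℝ) ^ (K - (n : ℤ)) * ‖ψ (K - (n : ℤ))‖) :
    IntegrableOn φ (closedBall 0 ((p : ℝ) ^ K)) μ := by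
  rw [closedBall_zpow_eq_singleton_union_iUnion_sphere]
  refine IntegrableOn.union (integrableOn_singleton (hx := isCompact_singleton.measure_lt_top)) <|
    integrableOn_iUnion_of_summable_integral_norm
      (fun n => integrableOn_sphere_zpow p μ hψ _) <|
    hint.of_nonneg_of_le (fun n => integral_nonneg fun x => norm_nonneg _) fun n => ?_
  rw [setIntegral_congr_fun isClosed_sphere.measurableSet
    (g := fun _ => ‖ψ (K - (n : ℤ))‖) fun x hx => by
      simp only [hψ x (K - (n : ℤ)) (by simpa using hx)], setIntegral_const, smul_eq_mul]
  gcongr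
  rw [measureReal_sphere_zpow p μ hμ]
  exact sub_le_self _ (by positivity)

theorem setIntegral_sphere_zpow (hμ : μ {x : ℚ_[p] | ‖x‖ ≤ 1} = 1)
    (hψ : ∀ (x : ℚ_[p]) (k : ℤ), ‖x‖ = (p : ℝ) ^ k → φ x = ψ k) (k : ℤ) :
    ∫ x in sphere 0 ((p : ℝ) ^ k), φ x ∂μ =
      ((p : ℂ) ^ k - (p : ℂ) ^ (k - 1)) * ψ k := by
  rw [setIntegral_congr_fun isClosed_sphere.measurableSet
    (g := fun _ => ψ k) fun x hx => hψ x k (by simpa using hx), setIntegral_const,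
    measureReal_sphere_zpow p μ hμ, Complex.real_smul]
  push_cast
  rfl

theorem v0_mul_zpow_mul (p : ℕ) [Fact p.Prime] (φ : ℚ_[p] → ℂ) (n : ℤ) (x : ℚ_[p]) :
    v0 p (x * (p : ℚ_[p]) ^ (-n)) * φ x =
      (closedBall 0 ((p : ℝ) ^ (-n))).indicator φ x +
        -1 / ((p : ℂ) - 1) * (sphere 0 ((p : ℝ) ^ (1 - n))).indicator φ x := by
  have hpR : (0 : ℝ) < p := mod_cast (Fact.out : p.Prime).pos
  have hle : ‖x * (p : ℚ_[p]) ^ (-n)‖ ≤ 1 ↔ x ∈ closedBall 0 ((p : ℝ) ^ (-n)) := by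
    rw [norm_mul, Padic.norm_p_zpow, neg_neg, mem_closedBall, dist_zero_right, zpow_neg,
      ← one_div, le_div_iff₀ (by positivity)]
  have heq : ‖x * (p : ℚ_[p]) ^ (-n)‖ = p ↔ x ∈ sphere 0 ((p : ℝ) ^ (1 - n)) := by
    rw [norm_mul, Padic.norm_p_zpow, neg_neg, mem_sphere, dist_zero_right,
      zpow_sub₀ hpR.ne', zpow_one, eq_div_iff (by positivity)]
  have hdisj := disjoint_closedBall_zpow_sphere p (1 - n)
  rw [show (1 - n - 1 : ℤ) = -n by ring] at hdisj
  unfold v0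
  by_cases h : x ∈ closedBall 0 ((p : ℝ) ^ (-n))
  · rw [if_pos (hle.2 h), Set.indicator_of_mem h,
      Set.indicator_of_notMem (Set.disjoint_left.1 hdisj h)]
    simp
  · rw [if_neg (hle.not.2 h), Set.indicator_of_notMem h]
    by_cases h' : x ∈ sphere 0 ((p : ℝ) ^ (1 - n))
    · rw [if_pos (heq.2 h'), Set.indicator_of_mem h', zero_add]
    · rw [if_neg (heq.not.2 h'), Set.indicator_of_notMem h']
      simp

theorem Phi_eq (hμ : μ {x : ℚ_[p] | ‖x‖ ≤ 1} = 1)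
    (hψ : ∀ (x : ℚ_[p]) (k : ℤ), ‖x‖ = (p : ℝ) ^ k → φ x = ψ k)
    (n : ℤ) (hφ : IntegrableOn φ (closedBall 0 ((p : ℝ) ^ (-n))) μ) :
    Phi p μ φ n = ∫ x in closedBall 0 ((p : ℝ) ^ (-n)), φ x ∂μ - (p : ℂ) ^ (-n) * ψ (1 - n) := by
  have hp0 : (p : ℂ) ≠ 0 := mod_cast (Fact.out : p.Prime).ne_zero
  have hp1 : (p : ℂ) - 1 ≠ 0 := sub_ne_zero.2 (mod_cast (Fact.out : p.Prime).ne_one)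
  have hS : MeasurableSet (sphere (0 : ℚ_[p]) ((p : ℝ) ^ (1 - n))) :=
    isClosed_sphere.measurableSet
  simp only [Phi, laplace, v0_mul_zpow_mul]
  rw [integral_add (hφ.integrable_indicator measurableSet_closedBall)
      (((integrableOn_sphere_zpow p μ hψ _).integrable_indicator hS).const_mul _),
    integral_const_mul, integral_indicator measurableSet_closedBall, integral_indicator hS,
    setIntegral_sphere_zpow p μ hμ hψ, show (1 - n - 1 : ℤ) = -n by ring,
    show (1 - n : ℤ) = -n + 1 by ring, zpow_add_one₀ hp0]
  field_simp
  ring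

/-- The difference of consecutive values of the transform recovers a difference of values of `ψ`. -/
theorem zpow_mul_Phi_sub_Phi_add_one (hμ : μ {x : ℚ_[p] | ‖x‖ ≤ 1} = 1)
    (hψ : ∀ (x : ℚ_[p]) (k : ℤ), ‖x‖ = (p : ℝ) ^ k → φ x = ψ k)
    (hφ : ∀ K : ℤ, IntegrableOn φ (closedBall 0 ((p : ℝ) ^ K)) μ) (n : ℤ) :
    (p : ℂ) ^ n * (Phi p μ φ n - Phi p μ φ (n + 1)) = ψ (-n) - ψ (1 - n) := by
  have hp0 : (p : ℂ) ≠ 0 := mod_cast (Fact.out : p.Prime).ne_zero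
  rw [Phi_eq p μ hμ hψ n (hφ _), Phi_eq p μ hμ hψ (n + 1) (hφ _),
    closedBall_zpow_eq_union_sphere, show (-n - 1 : ℤ) = -(n + 1) by ring,
    setIntegral_union _ isClosed_sphere.measurableSet (hφ _) (integrableOn_sphere_zpow p μ hψ _),
    setIntegral_sphere_zpow p μ hμ hψ, show (-n - 1 : ℤ) = -(n + 1) by ring,
    show (1 - (n + 1) : ℤ) = -n by ring, zpow_neg, zpow_neg]
  · field_simp
    ring
  · have := disjoint_closedBall_zpow_sphere p (-n)
    rwa [show (-n - 1 : ℤ) = -(n + 1) by ring] at this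

end Radial

end Haar

/-- Inversion formula for the Laplace-type transform: for every `m ≥ 1`,
`ψ(m) = ψ(0) + ∑_{j=0}^{m−1} p^{-j}[Φ(−j+1) − Φ(−j)]` and
`ψ(−m) = ψ(0) + ∑_{j=1}^{m} p^{j}[Φ(j) − Φ(j+1)]`. -/
theorem statement18
    (μ : Measure ℚ_[p]) [μ.IsAddHaarMeasure]
    (hμ : μ {x : ℚ_[p] | ‖x‖ ≤ 1} = 1)
    (φ : ℚ_[p] → ℂ) (ψ : ℤ → ℂ)
    (hψ : ∀ (x : ℚ_[p]) (k : ℤ), ‖x‖ = (p : ℝ) ^ k → φ x = ψ k)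
    (hint : ∀ K : ℤ, Summable (fun n : ℕ => (p : ℝ) ^ (K - (n : ℤ)) * ‖ψ (K - (n : ℤ))‖)) :
    ∀ m : ℕ, 1 ≤ m →
      (ψ (m : ℤ) = ψ 0 + ∑ j ∈ Finset.range m,
          (((p : ℝ) ^ (-(j : ℤ)) : ℝ) : ℂ) *
            (Phi p μ φ (-(j : ℤ) + 1) - Phi p μ φ (-(j : ℤ)))) ∧
      (ψ (-(m : ℤ)) = ψ 0 + ∑ j ∈ Finset.range m,
          (((p : ℝ) ^ ((j : ℤ) + 1) : ℝ) : ℂ) *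
            (Phi p μ φ ((j : ℤ) + 1) - Phi p μ φ ((j : ℤ) + 2))) := by
  have hφ (K : ℤ) := integrableOn_closedBall_zpow p μ hμ hψ (hint K)
  have key := zpow_mul_Phi_sub_Phi_add_one p μ hμ hψ hφ
  refine fun m _ => ⟨?_, ?_⟩
  · have h (j : ℕ) : (((p : ℝ) ^ (-(j : ℤ)) : ℝ) : ℂ) *
        (Phi p μ φ (-(j : ℤ) + 1) - Phi p μ φ (-(j : ℤ))) = ψ ((j + 1 : ℕ) : ℤ) - ψ (j : ℤ) := by
      have := key (-(j : ℤ))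
      rw [neg_neg, sub_neg_eq_add, add_comm 1 (j : ℤ)] at this
      push_cast
      linear_combination -this
    simp only [h, Finset.sum_range_sub fun j : ℕ => ψ (j : ℤ)]
    simp
  · have h (j : ℕ) : (((p : ℝ) ^ ((j : ℤ) + 1) : ℝ) : ℂ) *
        (Phi p μ φ ((j : ℤ) + 1) - Phi p μ φ ((j : ℤ) + 2)) =
          ψ (-((j + 1 : ℕ) : ℤ)) - ψ (-(j : ℤ)) := by
      have := key ((j : ℤ) + 1)
      rw [add_assoc, one_add_one_eq_two, show (1 - ((j : ℤ) + 1)) = -j by ring] at this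
      push_cast
      exact this
    simp only [h, Finset.sum_range_sub fun j : ℕ => ψ (-(j : ℤ))]
    simp
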